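/- For every real number x < 0, one has ((1 − Φ(x))²/φ(x)) · ∫_{−∞}^{x} Φ(y)²/φ(y) dy ≤ 1/|x|³. -/

import Mathlib

open Real MeasureTheory

/-- The standard normal density. -/
noncomputable def stdNormalPDF (x : ℝ) : ℝ := (Real.sqrt (2 * Real.pi))⁻¹ * Real.exp (-x ^ 2 / 2)

/-- The standard normal distribution function. -/
noncomputable def stdNormalCDF (x : ℝ) : ℝ := ∫ t in Set.Iic x, stdNormalPDF t

lemma stdNormalPDF_pos (x : ℝ) : 0 < stdNormalPDF x := by
  unfold stdNormalPDF
  positivity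

lemma stdNormalPDF_eq_gaussianPDFReal (x : ℝ) :
    stdNormalPDF x = ProbabilityTheory.gaussianPDFReal 0 1 x := by
  simp [stdNormalPDF, ProbabilityTheory.gaussianPDFReal]

lemma integrable_stdNormalPDF : Integrable stdNormalPDF := by
  rw [funext stdNormalPDF_eq_gaussianPDFReal]
  exact ProbabilityTheory.integrable_gaussianPDFReal 0 1

lemma integral_stdNormalPDF : ∫ x, stdNormalPDF x = 1 := by
  rw [funext stdNormalPDF_eq_gaussianPDFReal]
  exact ProbabilityTheory.integral_gaussianPDFReal_eq_one 0 one_ne_zero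

lemma stdNormalCDF_nonneg (x : ℝ) : 0 ≤ stdNormalCDF x :=
  integral_nonneg fun t => (stdNormalPDF_pos t).le

lemma stdNormalCDF_le_one (x : ℝ) : stdNormalCDF x ≤ 1 := by
  rw [← integral_stdNormalPDF]
  exact setIntegral_le_integral integrable_stdNormalPDF
    (Filter.Eventually.of_forall fun t => (stdNormalPDF_pos t).le)

lemma hasDerivAt_stdNormalPDF (x : ℝ) :
    HasDerivAt stdNormalPDF (-x * stdNormalPDF x) x := by
  have h : HasDerivAt (fun y : ℝ => -y ^ 2 / 2) (-x) x := by
    refine ((hasDerivAt_pow 2 x).neg.div_const 2).congr_deriv ?_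
    norm_num
    ring
  refine (h.exp.const_mul (Real.sqrt (2 * Real.pi))⁻¹).congr_deriv ?_
  unfold stdNormalPDF
  ring

lemma integrable_neg_mul_stdNormalPDF : Integrable fun x => -x * stdNormalPDF x := by
  convert (integrable_mul_exp_neg_mul_sq (b := 1 / 2) (by norm_num)).const_mul
    (-(Real.sqrt (2 * Real.pi))⁻¹) using 2 with x
  unfold stdNormalPDF
  rw [show -x ^ 2 / 2 = -(1 / 2) * x ^ 2 by ring]
  ring

lemma integral_Iic_neg_mul_stdNormalPDF (x : ℝ) :
    ∫ y in Set.Iic x, -y * stdNormalPDF y = stdNormalPDF x := by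
  have h := integral_Iic_of_hasDerivAt_of_tendsto' (a := x)
    (fun y _ => hasDerivAt_stdNormalPDF y) integrable_neg_mul_stdNormalPDF.integrableOn
    (tendsto_zero_of_hasDerivAt_of_integrableOn_Iic (a := x)
      (fun y _ => hasDerivAt_stdNormalPDF y)
      integrable_neg_mul_stdNormalPDF.integrableOn integrable_stdNormalPDF.integrableOn)
  simpa using h

/-- The upper Mills ratio bound for the lower tail of the standard normal distribution. -/
lemma neg_mul_stdNormalCDF_le {x : ℝ} : -x * stdNormalCDF x ≤ stdNormalPDF x := by
  rw [← integral_Iic_neg_mul_stdNormalPDF x, stdNormalCDF, ← integral_const_mul]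
  refine setIntegral_mono_on (integrable_stdNormalPDF.const_mul _).integrableOn
    integrable_neg_mul_stdNormalPDF.integrableOn measurableSet_Iic fun y hy => ?_
  exact mul_le_mul_of_nonneg_right (neg_le_neg hy) (stdNormalPDF_pos y).le

lemma sq_stdNormalCDF_div_le {x y : ℝ} (hx : x < 0) (hy : y ≤ x) :
    stdNormalCDF y ^ 2 / stdNormalPDF y ≤ 1 / |x| ^ 3 * (-y * stdNormalPDF y) := by
  have hp := stdNormalPDF_pos y
  have hx' : 0 < -x := neg_pos.2 hx
  have hxy : -x ≤ -y := neg_le_neg hy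
  have hy' : 0 < -y := hx'.trans_le hxy
  rw [abs_of_neg hx, div_le_iff₀ hp, div_mul_eq_mul_div, div_mul_eq_mul_div,
    le_div_iff₀ (by positivity)]
  have hsq : (-y * stdNormalCDF y) ^ 2 ≤ stdNormalPDF y ^ 2 :=
    pow_le_pow_left₀ (mul_nonneg hy'.le (stdNormalCDF_nonneg y)) neg_mul_stdNormalCDF_le 2
  calc stdNormalCDF y ^ 2 * (-x) ^ 3 ≤ stdNormalCDF y ^ 2 * (-y) ^ 3 := by gcongr
    _ = -y * (-y * stdNormalCDF y) ^ 2 := by ring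
    _ ≤ -y * stdNormalPDF y ^ 2 := by gcongr
    _ = 1 * (-y * stdNormalPDF y) * stdNormalPDF y := by ring

lemma integral_Iic_sq_stdNormalCDF_div_le {x : ℝ} (hx : x < 0) :
    ∫ y in Set.Iic x, stdNormalCDF y ^ 2 / stdNormalPDF y ≤ 1 / |x| ^ 3 * stdNormalPDF x := by
  rw [← integral_Iic_neg_mul_stdNormalPDF x, ← integral_const_mul]
  refine integral_mono_of_nonneg
    (Filter.Eventually.of_forall fun y => div_nonneg (sq_nonneg _) (stdNormalPDF_pos y).le)
    (integrable_neg_mul_stdNormalPDF.const_mul _).integrableOn ?_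
  exact (ae_restrict_mem measurableSet_Iic).mono fun y hy => sq_stdNormalCDF_div_le hx hy

theorem stmt_5 (x : ℝ) (hx : x < 0) :
    (1 - stdNormalCDF x) ^ 2 / stdNormalPDF x *
        ∫ y in Set.Iic x, stdNormalCDF y ^ 2 / stdNormalPDF y ≤ 1 / |x| ^ 3 := by
  have hp := stdNormalPDF_pos x
  have h1 : (1 - stdNormalCDF x) ^ 2 ≤ 1 :=
    pow_le_one₀ (sub_nonneg.2 (stdNormalCDF_le_one x)) (sub_le_self _ (stdNormalCDF_nonneg x))
  calc (1 - stdNormalCDF x) ^ 2 / stdNormalPDF x *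
        ∫ y in Set.Iic x, stdNormalCDF y ^ 2 / stdNormalPDF y
      ≤ (1 - stdNormalCDF x) ^ 2 / stdNormalPDF x * (1 / |x| ^ 3 * stdNormalPDF x) := by
        gcongr
        exact integral_Iic_sq_stdNormalCDF_div_le hx
    _ = (1 - stdNormalCDF x) ^ 2 * (1 / |x| ^ 3) := by field_simp
    _ ≤ 1 / |x| ^ 3 := mul_le_of_le_one_left (by positivity) h1
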